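/- Let d ≥ 1 be an integer, 1 ≤ p < ∞, 1 ≤ v < ∞ with d = 2v. Suppose there is a constant c > 0 such that for every n ∈ ℕ the prior concentrations satisfy α_{j,b_n} ≥ 0 for all j ∈ {1,…,b_n}^d and Σ_{j ∈ {1,…,b_n}^d} α_{j,b_n} ≤ c·n^{1/2}. Then there exist a constant C > 0 (depending only on d, v, p, c) and N ≥ 2 such that for every n ≥ N, every Borel probability measure P₀ on [0,1)^d, and Y₁,…,Y_n i.i.d. with law P₀, the expectation over the sample satisfies E[W_v(P₀, P̄_n)] ≤ C·n^{-1/(2v)}·(log n)^{1/v}. -/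

import Mathlib

open MeasureTheory Filter
open scoped ENNReal NNReal Classical BigOperators

noncomputable section

/-- ℓ^p distance on ℝ^d. -/
def lpDist (p : ℝ) {d : ℕ} (x y : Fin d → ℝ) : ℝ :=
  (∑ l, |x l - y l| ^ p) ^ (1 / p)

/-- Wasserstein-v distance with respect to the ℓ^p metric, via couplings. -/
def wassersteinLp (p v : ℝ) {d : ℕ} (μ ν : Measure (Fin d → ℝ)) : ℝ :=
  sInf { r : ℝ | ∃ π : Measure ((Fin d → ℝ) × (Fin d → ℝ)),
      IsProbabilityMeasure π ∧ π.map Prod.fst = μ ∧ π.map Prod.snd = ν ∧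
      r = ∫ z, lpDist p z.1 z.2 ^ v ∂π } ^ (1 / v)

/-- The cube [0,1)^d. -/
def cube (d : ℕ) : Set (Fin d → ℝ) := {x | ∀ l, 0 ≤ x l ∧ x l < 1}

/-- The bin A_{i,b} (0-indexed): ∏_l [i_l/b, (i_l+1)/b). -/
def binSet (d b : ℕ) (i : Fin d → Fin b) : Set (Fin d → ℝ) :=
  {x | ∀ l, (i l : ℝ) / b ≤ x l ∧ x l < ((i l : ℝ) + 1) / b}

/-- Histogram probability measure with weights `w`: density Σ_i b^d w_i 1_{A_{i,b}}. -/
def histMeasure (d b : ℕ) (w : (Fin d → Fin b) → ℝ) : Measure (Fin d → ℝ) :=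
  volume.withDensity fun x =>
    ENNReal.ofReal (∑ i, (b : ℝ) ^ d * w i * Set.indicator (binSet d b i) 1 x)

/-- k_n = n^{1/(2v)} if d ≤ 2v, else n^{1/d}. -/
def kSeq (d : ℕ) (v : ℝ) (n : ℕ) : ℝ :=
  if (d : ℝ) ≤ 2 * v then (n : ℝ) ^ ((1 : ℝ) / (2 * v)) else (n : ℝ) ^ ((1 : ℝ) / d)

/-- K_n = ⌈log₂ k_n⌉. -/
def KSeq (d : ℕ) (v : ℝ) (n : ℕ) : ℕ := ⌈Real.logb 2 (kSeq d v n)⌉₊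

/-- b_n = 2^{K_n}. -/
def bSeq (d : ℕ) (v : ℝ) (n : ℕ) : ℕ := 2 ^ KSeq d v n

/-- Bin count N_j. -/
def binCount (d b : ℕ) {n : ℕ} (Y : Fin n → Fin d → ℝ) (j : Fin d → Fin b) : ℕ :=
  (Finset.univ.filter fun t => Y t ∈ binSet d b j).card

/-- Posterior mean weights π̂_j = (α_j + N_j)/(n + Σ_i α_i). -/
def postWeight (d b : ℕ) {n : ℕ} (α : (Fin d → Fin b) → ℝ) (Y : Fin n → Fin d → ℝ)
    (j : Fin d → Fin b) : ℝ :=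
  (α j + binCount d b Y j) / (n + ∑ i, α i)

/-- The posterior mean histogram P̄_n. -/
def postMeanHist (d : ℕ) (v : ℝ) {n : ℕ} (α : (Fin d → Fin (bSeq d v n)) → ℝ)
    (Y : Fin n → Fin d → ℝ) : Measure (Fin d → ℝ) :=
  histMeasure d (bSeq d v n) (postWeight d (bSeq d v n) α Y)

/-- Dirichlet(β) as the law of normalized independent Gammas. -/
def dirichlet {ι : Type*} [Fintype ι] (β : ι → ℝ) : Measure (ι → ℝ) :=
  (Measure.pi fun i => ProbabilityTheory.gammaMeasure (β i) 1).map
    fun g i => g i / ∑ j, g j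


/-- Two finite measures can be partially coupled inside the cells of a finite partition, so that the
uncoupled part of the first one has in each cell exactly the excess mass. -/
lemma exists_partial_coupling {X ι : Type*} [MeasurableSpace X] [Fintype ι] [MeasurableSpace ι]
    [MeasurableSingletonClass ι] {q : X → ι} (hq : Measurable q) (μ ν : Measure X)
    [IsFiniteMeasure μ] [IsFiniteMeasure ν] :
    ∃ (γ : Measure (X × X)) (μ' ν' : Measure X),
      γ.map Prod.fst + μ' = μ ∧ γ.map Prod.snd + ν' = ν ∧ (∀ᵐ z ∂γ, q z.1 = q z.2) ∧
      (∀ i, μ' (q ⁻¹' {i}) = μ (q ⁻¹' {i}) - ν (q ⁻¹' {i})) := by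
  have hQ : ∀ i, MeasurableSet (q ⁻¹' {i}) := fun i => hq (measurableSet_singleton i)
  have hdecomp : ∀ ρ : Measure X, ∑ i, ρ.restrict (q ⁻¹' {i}) = ρ := by
    intro ρ
    have h := Measure.restrict_iUnion (μ := ρ)
      (s := fun i => q ⁻¹' {i}) (fun i j hij => Disjoint.preimage q (by simpa using hij)) hQ
    have hU : (⋃ i, q ⁻¹' {i}) = Set.univ := by ext x; simp
    rw [hU, Measure.restrict_univ, Measure.sum_fintype] at h
    exact h.symm
  set a : ι → ℝ≥0∞ := fun i => μ (q ⁻¹' {i}) with ha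
  set b : ι → ℝ≥0∞ := fun i => ν (q ⁻¹' {i}) with hb
  have ha' : ∀ i, a i ≠ ∞ := fun i => measure_ne_top _ _
  have hb' : ∀ i, b i ≠ ∞ := fun i => measure_ne_top _ _
  have hr : ∀ x y : ℝ≥0∞, min x y / x ≤ 1 := fun x y =>
    ENNReal.div_le_of_le_mul (by simp)
  have hcancel : ∀ x y : ℝ≥0∞, y ≠ 0 → x ≠ ∞ → y ≠ ∞ →
      min x y / (x * y) * y = min x y / x := by
    intro x y hy hx hy'
    rw [div_eq_mul_inv, ENNReal.mul_inv (Or.inr hy') (Or.inr hy), mul_assoc, mul_assoc,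
      ENNReal.inv_mul_cancel hy hy', mul_one, div_eq_mul_inv]
  refine ⟨∑ i, (min (a i) (b i) / (a i * b i)) •
      (μ.restrict (q ⁻¹' {i})).prod (ν.restrict (q ⁻¹' {i})),
    ∑ i, (1 - min (a i) (b i) / a i) • μ.restrict (q ⁻¹' {i}),
    ∑ i, (1 - min (a i) (b i) / b i) • ν.restrict (q ⁻¹' {i}), ?_, ?_, ?_, ?_⟩
  · rw [Measure.map_finset_sum (by fun_prop), ← Finset.sum_add_distrib]
    conv_rhs => rw [← hdecomp μ]
    refine Finset.sum_congr rfl fun i _ => ?_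
    rw [Measure.map_smul, Measure.map_fst_prod, smul_smul, ← add_smul,
      Measure.restrict_apply_univ]
    by_cases h0 : b i = 0
    · simp [h0]
    · change ((min (a i) (b i) / (a i * b i) * b i) + _) • _ = _
      rw [hcancel _ _ h0 (ha' i) (hb' i), add_tsub_cancel_of_le (hr _ _), one_smul]
  · rw [Measure.map_finset_sum (by fun_prop), ← Finset.sum_add_distrib]
    conv_rhs => rw [← hdecomp ν]
    refine Finset.sum_congr rfl fun i _ => ?_
    rw [Measure.map_smul, Measure.map_snd_prod, smul_smul, ← add_smul,
      Measure.restrict_apply_univ]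
    by_cases h0 : a i = 0
    · simp [h0]
    · change ((min (a i) (b i) / (a i * b i) * a i) + _) • _ = _
      rw [min_comm, mul_comm (a i), hcancel _ _ h0 (hb' i) (ha' i),
        add_tsub_cancel_of_le (hr _ _), one_smul]
  · rw [← Measure.sum_fintype, Measure.ae_sum_iff]
    intro i
    refine Measure.ae_smul_measure ?_ _
    rw [Measure.prod_restrict]
    filter_upwards [ae_restrict_mem ((hQ i).prod (hQ i))] with z hz
    obtain ⟨h1, h2⟩ := hz
    simp at h1 h2
    rw [h1, h2]
  · intro i
    rw [Measure.finsetSum_apply, Finset.sum_eq_single i]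
    · rw [Measure.smul_apply, Measure.restrict_apply (hQ i), Set.inter_self, smul_eq_mul,
        ENNReal.sub_mul (fun _ _ => ha' i), one_mul]
      change a i - _ / a i * a i = a i - b i
      rw [ENNReal.div_mul_cancel' (fun h => by simp [h]) (fun h => absurd h (ha' i))]
      exact tsub_min
    · intro j _ hji
      rw [Measure.smul_apply, Measure.restrict_apply (hQ i)]
      have : q ⁻¹' {i} ∩ q ⁻¹' {j} = ∅ := by
        ext x; simp; rintro rfl; exact fun h => hji h.symm
      simp [this]
    · simp

/-- Two measures of equal mass can be coupled along nested partitions, from the finest to the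
coarsest, at a cost controlled by the mass excesses over the cells of each level. -/
lemma exists_multiscale_coupling {X : Type*} [MeasurableSpace X] {ι : ℕ → Type*}
    [∀ k, Fintype (ι k)] [∀ k, MeasurableSpace (ι k)] [∀ k, MeasurableSingletonClass (ι k)]
    {q : ∀ k, X → ι k} (hq : ∀ k, Measurable (q k))
    (hnest : ∀ k K, k ≤ K → ∃ h : ι K → ι k, ∀ x, q k x = h (q K x))
    {S : Set X} {cost : X × X → ℝ≥0∞} {δ : ℕ → ℝ≥0∞}
    (h0 : ∀ x ∈ S, ∀ y ∈ S, cost (x, y) ≤ δ 0)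
    (hcost : ∀ k, ∀ x ∈ S, ∀ y ∈ S, q k x = q k y → cost (x, y) ≤ δ k) (K : ℕ) :
    ∀ (μ ν : Measure X) [IsFiniteMeasure μ] [IsFiniteMeasure ν],
      μ Set.univ = ν Set.univ → (∀ᵐ x ∂μ, x ∈ S) → (∀ᵐ x ∂ν, x ∈ S) →
      ∃ γ : Measure (X × X), γ.map Prod.fst = μ ∧ γ.map Prod.snd = ν ∧
        ∫⁻ z, cost z ∂γ ≤ δ K * μ Set.univ +
          ∑ k ∈ Finset.range K, δ k *
            ∑ i, (μ (q (k + 1) ⁻¹' {i}) - ν (q (k + 1) ⁻¹' {i})) := by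
  have hsupp : ∀ (γ : Measure (X × X)) (μ ν : Measure X), γ.map Prod.fst ≤ μ →
      γ.map Prod.snd ≤ ν → (∀ᵐ x ∂μ, x ∈ S) → (∀ᵐ x ∂ν, x ∈ S) →
      ∀ᵐ z ∂γ, z.1 ∈ S ∧ z.2 ∈ S := by
    intro γ μ ν h1 h2 hμ hν
    have e1 := ae_of_ae_map (by fun_prop) (h1.absolutelyContinuous.ae_le hμ)
    have e2 := ae_of_ae_map (by fun_prop) (h2.absolutelyContinuous.ae_le hν)
    filter_upwards [e1, e2] with z a b using ⟨a, b⟩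
  have hint : ∀ (γ : Measure (X × X)) (μ : Measure X) (t : ℝ≥0∞), γ.map Prod.fst ≤ μ →
      (∀ᵐ z ∂γ, cost z ≤ t) → ∫⁻ z, cost z ∂γ ≤ t * μ Set.univ := by
    intro γ μ t h1 h
    calc ∫⁻ z, cost z ∂γ ≤ ∫⁻ z, t ∂γ := lintegral_mono_ae h
      _ = t * (γ.map Prod.fst) Set.univ := by
        rw [lintegral_const, Measure.map_apply measurable_fst .univ, Set.preimage_univ]
      _ ≤ _ := by gcongr
  induction K with
  | zero =>
    intro μ ν _ _ hμν hμ hν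
    by_cases hz : μ Set.univ = 0
    · have hν0 : ν = 0 := Measure.measure_univ_eq_zero.1 (hμν ▸ hz)
      have hμ0 : μ = 0 := Measure.measure_univ_eq_zero.1 hz
      exact ⟨0, by simp [hμ0], by simp [hν0], by simp⟩
    · have hc1 : (μ Set.univ)⁻¹ * μ Set.univ = 1 :=
        ENNReal.inv_mul_cancel hz (measure_ne_top _ _)
      have hfst : ((μ Set.univ)⁻¹ • μ.prod ν).map Prod.fst = μ := by
        rw [Measure.map_smul, Measure.map_fst_prod, smul_smul, ← hμν, hc1, one_smul]
      have hsnd : ((μ Set.univ)⁻¹ • μ.prod ν).map Prod.snd = ν := by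
        rw [Measure.map_smul, Measure.map_snd_prod, smul_smul, hc1, one_smul]
      refine ⟨(μ Set.univ)⁻¹ • μ.prod ν, hfst, hsnd, ?_⟩
      rw [Finset.range_zero, Finset.sum_empty, add_zero]
      refine hint _ _ _ hfst.le ?_
      filter_upwards [hsupp _ _ _ hfst.le hsnd.le hμ hν] with z hz
      exact h0 _ hz.1 _ hz.2
  | succ K ih =>
    intro μ ν _ _ hμν hμ hν
    obtain ⟨γ, μ', ν', h1, h2, hd, hm⟩ := exists_partial_coupling (hq (K + 1)) μ ν
    have hγμ : γ.map Prod.fst ≤ μ := h1 ▸ Measure.le_add_right le_rfl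
    have hγν : γ.map Prod.snd ≤ ν := h2 ▸ Measure.le_add_right le_rfl
    have hμ' : μ' ≤ μ := h1 ▸ Measure.le_add_left le_rfl
    have hν' : ν' ≤ ν := h2 ▸ Measure.le_add_left le_rfl
    have : IsFiniteMeasure μ' := isFiniteMeasure_of_le μ hμ'
    have : IsFiniteMeasure ν' := isFiniteMeasure_of_le ν hν'
    have hγfin : ∀ s : Set X, (γ.map Prod.fst) s ≠ ∞ := fun s =>
      ((hγμ s).trans_lt (measure_lt_top μ s)).ne
    have htot : (γ.map Prod.fst) Set.univ = (γ.map Prod.snd) Set.univ := by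
      rw [Measure.map_apply measurable_fst .univ, Measure.map_apply measurable_snd .univ,
        Set.preimage_univ, Set.preimage_univ]
    have hmass : μ' Set.univ = ν' Set.univ := by
      have e : (γ.map Prod.fst + μ') Set.univ = (γ.map Prod.snd + ν') Set.univ := by
        rw [h1, h2, hμν]
      rw [Measure.add_apply, Measure.add_apply, ← htot] at e
      exact (ENNReal.add_right_inj (hγfin _)).1 e
    have hdiff : ∀ k ≤ K + 1, ∀ i, μ' (q k ⁻¹' {i}) - ν' (q k ⁻¹' {i}) =
        μ (q k ⁻¹' {i}) - ν (q k ⁻¹' {i}) := by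
      intro k hk i
      have hQ : MeasurableSet (q k ⁻¹' {i}) := hq k (measurableSet_singleton i)
      have e : (γ.map Prod.fst) (q k ⁻¹' {i}) = (γ.map Prod.snd) (q k ⁻¹' {i}) := by
        rw [Measure.map_apply measurable_fst hQ, Measure.map_apply measurable_snd hQ]
        refine measure_congr ?_
        obtain ⟨h, hh⟩ := hnest k (K + 1) hk
        filter_upwards [hd] with z hz
        refine propext ?_
        change q k z.1 = i ↔ q k z.2 = i
        rw [hh, hh, hz]
      conv_rhs => rw [← h1, ← h2, Measure.add_apply, Measure.add_apply, ← e]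
      exact (ENNReal.add_sub_add_eq_sub_left (hγfin _)).symm
    obtain ⟨γ', g1, g2, hg⟩ := ih μ' ν' hmass (hμ'.absolutelyContinuous.ae_le hμ)
      (hν'.absolutelyContinuous.ae_le hν)
    refine ⟨γ + γ', ?_, ?_, ?_⟩
    · rw [Measure.map_add _ _ measurable_fst, g1, h1]
    · rw [Measure.map_add _ _ measurable_snd, g2, h2]
    · rw [lintegral_add_measure, Finset.sum_range_succ]
      have b1 : ∫⁻ z, cost z ∂γ ≤ δ (K + 1) * μ Set.univ := by
        refine hint _ _ _ hγμ ?_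
        filter_upwards [hsupp _ _ _ hγμ hγν hμ hν, hd] with z hz hz'
        exact hcost _ _ hz.1 _ hz.2 hz'
      have b2 : μ' Set.univ =
          ∑ i, (μ (q (K + 1) ⁻¹' {i}) - ν (q (K + 1) ⁻¹' {i})) := by
        simp_rw [← hm]
        rw [sum_measure_preimage_singleton _ fun i _ => hq _ (measurableSet_singleton i)]
        simp
      have b3 : ∑ k ∈ Finset.range K, δ k *
            ∑ i, (μ' (q (k + 1) ⁻¹' {i}) - ν' (q (k + 1) ⁻¹' {i})) =
          ∑ k ∈ Finset.range K, δ k *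
            ∑ i, (μ (q (k + 1) ⁻¹' {i}) - ν (q (k + 1) ⁻¹' {i})) := by
        refine Finset.sum_congr rfl fun k hk => ?_
        have := Finset.mem_range.1 hk
        congr 1
        exact Finset.sum_congr rfl fun i _ => hdiff _ (by omega) i
      rw [b2, b3] at hg
      calc _ ≤ _ := add_le_add b1 hg
        _ = _ := by ring

/-- The index of the dyadic cell of side `2⁻ᵏ` containing a point of the cube
(reduced modulo `2 ^ k` outside of the cube). -/
def gridIndex {d : ℕ} (k : ℕ) (x : Fin d → ℝ) : Fin d → Fin (2 ^ k) :=
  fun l => ⟨⌊x l * (2 ^ k : ℕ)⌋₊ % 2 ^ k, Nat.mod_lt _ (by positivity)⟩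

lemma measurable_gridIndex {d : ℕ} (k : ℕ) : Measurable (gridIndex (d := d) k) := by
  refine measurable_pi_lambda _ fun l => ?_
  have h : Measurable fun m : ℕ => (⟨m % 2 ^ k, Nat.mod_lt _ (by positivity)⟩ : Fin (2 ^ k)) :=
    measurable_from_top
  exact h.comp (Nat.measurable_floor.comp ((measurable_pi_apply l).mul_const _))

lemma gridIndex_factors {d k K : ℕ} (hkK : k ≤ K) :
    ∃ h : (Fin d → Fin (2 ^ K)) → (Fin d → Fin (2 ^ k)),
      ∀ x, gridIndex k x = h (gridIndex K x) := by
  refine ⟨fun j l => ⟨(j l : ℕ) / 2 ^ (K - k), ?_⟩, fun x => ?_⟩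
  · rw [Nat.div_lt_iff_lt_mul (by positivity), ← pow_add, Nat.add_sub_cancel' hkK]
    exact (j l).2
  · funext l
    have hK : 2 ^ K = 2 ^ (K - k) * 2 ^ k := by rw [← pow_add, Nat.sub_add_cancel hkK]
    have hx : x l * (2 ^ k : ℕ) = x l * (2 ^ K : ℕ) / (2 ^ (K - k) : ℕ) := by
      rw [hK, Nat.cast_mul]
      field_simp
    simp only [gridIndex, Fin.mk.injEq]
    rw [hx, Nat.floor_div_natCast]
    conv_rhs => rw [hK, Nat.mod_mul_right_div_self]
    rw [← hK]

lemma gridIndex_val_of_mem_cube {d k : ℕ} {x : Fin d → ℝ} (hx : x ∈ cube d) (l : Fin d) :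
    (gridIndex k x l : ℕ) = ⌊x l * (2 ^ k : ℕ)⌋₊ := by
  refine Nat.mod_eq_of_lt ((Nat.floor_lt (mul_nonneg (hx l).1 (by positivity))).2 ?_)
  have : (0 : ℝ) < (2 ^ k : ℕ) := by positivity
  nlinarith [(hx l).2]

lemma binSet_subset_cube {d b : ℕ} (hb : 0 < b) (j : Fin d → Fin b) : binSet d b j ⊆ cube d := by
  intro x hx l
  have hb' : (0 : ℝ) < b := by exact_mod_cast hb
  refine ⟨le_trans (by positivity) (hx l).1, (hx l).2.trans_le ?_⟩
  rw [div_le_one hb']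
  exact_mod_cast (j l).2

lemma mem_binSet_iff {d K : ℕ} {x : Fin d → ℝ} (hx : x ∈ cube d) (j : Fin d → Fin (2 ^ K)) :
    x ∈ binSet d (2 ^ K) j ↔ gridIndex K x = j := by
  rw [funext_iff]
  refine forall_congr' fun l => ?_
  have h2 : (0 : ℝ) < (2 ^ K : ℕ) := by positivity
  rw [Fin.ext_iff, gridIndex_val_of_mem_cube hx,
    Nat.floor_eq_iff (mul_nonneg (hx l).1 h2.le), div_le_iff₀ h2, lt_div_iff₀ h2]

lemma lpDist_nonneg (p : ℝ) {d : ℕ} (x y : Fin d → ℝ) : 0 ≤ lpDist p x y :=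
  Real.rpow_nonneg (Finset.sum_nonneg fun _ _ => Real.rpow_nonneg (abs_nonneg _) _) _

lemma measurable_lpDist (p : ℝ) {d : ℕ} :
    Measurable fun z : (Fin d → ℝ) × (Fin d → ℝ) => lpDist p z.1 z.2 := by
  unfold lpDist
  fun_prop

lemma lpDist_rpow_le {p v : ℝ} (hp : 1 ≤ p) (hv : 1 ≤ v) {d k : ℕ} {x y : Fin d → ℝ}
    (hx : x ∈ cube d) (hy : y ∈ cube d) (hxy : gridIndex k x = gridIndex k y) :
    lpDist p x y ^ v ≤ ((d : ℝ) ^ (1 / p)) ^ v * ((2 : ℝ) ^ v)⁻¹ ^ k := by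
  have h2 : (0 : ℝ) < (2 ^ k : ℕ) := by positivity
  have hcoord : ∀ l, |x l - y l| ≤ ((2 : ℝ) ^ k)⁻¹ := by
    intro l
    have e : ⌊x l * (2 ^ k : ℕ)⌋₊ = ⌊y l * (2 ^ k : ℕ)⌋₊ := by
      rw [← gridIndex_val_of_mem_cube hx, ← gridIndex_val_of_mem_cube hy, hxy]
    have hx1 := Nat.floor_le (mul_nonneg (hx l).1 h2.le)
    have hx2 := Nat.lt_floor_add_one (x l * (2 ^ k : ℕ))
    have hy1 := Nat.floor_le (mul_nonneg (hy l).1 h2.le)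
    have hy2 := Nat.lt_floor_add_one (y l * (2 ^ k : ℕ))
    rw [e] at hx1 hx2
    rw [← mul_le_mul_iff_left₀ h2]
    have : ((2 : ℝ) ^ k)⁻¹ * (2 ^ k : ℕ) = 1 := by
      push_cast
      exact inv_mul_cancel₀ (by positivity)
    have habs : |x l - y l| * (2 ^ k : ℕ) = |x l * (2 ^ k : ℕ) - y l * (2 ^ k : ℕ)| := by
      rw [← sub_mul, abs_mul, abs_of_pos h2]
    rw [this, habs, abs_le]
    constructor <;> linarith
  have hp0 : 0 < p := by linarith
  have hdist : lpDist p x y ≤ (d : ℝ) ^ (1 / p) * ((2 : ℝ) ^ k)⁻¹ := by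
    calc lpDist p x y ≤ (∑ _l : Fin d, (((2 : ℝ) ^ k)⁻¹) ^ p) ^ (1 / p) := by
          unfold lpDist
          gcongr with l
          exact hcoord l
      _ = _ := by
          rw [Finset.sum_const, Finset.card_univ, Fintype.card_fin, nsmul_eq_mul,
            Real.mul_rpow (by positivity) (by positivity), ← Real.rpow_mul (by positivity),
            mul_one_div_cancel hp0.ne', Real.rpow_one]
  calc lpDist p x y ^ v ≤ ((d : ℝ) ^ (1 / p) * ((2 : ℝ) ^ k)⁻¹) ^ v :=
        Real.rpow_le_rpow (lpDist_nonneg _ _ _) hdist (by linarith)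
    _ = _ := by
        rw [Real.mul_rpow (by positivity) (by positivity), Real.inv_rpow (by positivity),
          inv_pow, ← Real.rpow_natCast_mul zero_le_two, ← Real.rpow_mul_natCast zero_le_two,
          mul_comm v]

lemma binSet_eq_pi (d b : ℕ) (j : Fin d → Fin b) :
    binSet d b j = Set.univ.pi fun l => Set.Ico ((j l : ℝ) / b) (((j l : ℝ) + 1) / b) := by
  ext x
  simp [binSet]

lemma measurableSet_binSet (d b : ℕ) (j : Fin d → Fin b) : MeasurableSet (binSet d b j) := by
  rw [binSet_eq_pi]
  exact MeasurableSet.univ_pi fun _ => measurableSet_Ico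

lemma ofReal_mul_volume_binSet {d b : ℕ} (hb : 0 < b) (j : Fin d → Fin b) (w : ℝ) :
    ENNReal.ofReal ((b : ℝ) ^ d * w) * volume (binSet d b j) = ENNReal.ofReal w := by
  have hb' : (0 : ℝ) < b := by exact_mod_cast hb
  have hvol : volume (binSet d b j) = ENNReal.ofReal (((b : ℝ) ^ d)⁻¹) := by
    rw [binSet_eq_pi, Real.volume_pi_Ico]
    have : ∀ l, ((j l : ℝ) + 1) / b - (j l : ℝ) / b = (b : ℝ)⁻¹ := by
      intro l
      field_simp
      ring
    simp_rw [this]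
    rw [Finset.prod_const, Finset.card_univ, Fintype.card_fin, ← ENNReal.ofReal_pow (by positivity),
      inv_pow]
  rw [hvol, ENNReal.ofReal_mul (by positivity), mul_right_comm, ← ENNReal.ofReal_mul (by positivity),
    mul_inv_cancel₀ (by positivity), ENNReal.ofReal_one, one_mul]

lemma histMeasure_apply {d b : ℕ} {w : (Fin d → Fin b) → ℝ} (hw : ∀ j, 0 ≤ w j)
    {S : Set (Fin d → ℝ)} (hS : MeasurableSet S) :
    histMeasure d b w S =
      ∑ j, ENNReal.ofReal ((b : ℝ) ^ d * w j) * volume (binSet d b j ∩ S) := by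
  have hdens : ∀ x, ENNReal.ofReal
      (∑ j, (b : ℝ) ^ d * w j * Set.indicator (binSet d b j) 1 x) =
      ∑ j, ENNReal.ofReal ((b : ℝ) ^ d * w j) * Set.indicator (binSet d b j) 1 x := by
    intro x
    have h0 : ∀ j, (0 : ℝ) ≤ (b : ℝ) ^ d * w j := fun j => mul_nonneg (by positivity) (hw j)
    have h1 : ∀ j, (0 : ℝ) ≤ Set.indicator (binSet d b j) 1 x :=
      fun j => Set.indicator_nonneg (fun _ _ => zero_le_one) _
    rw [ENNReal.ofReal_sum_of_nonneg fun j _ => mul_nonneg (h0 j) (h1 j)]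
    refine Finset.sum_congr rfl fun j _ => ?_
    rw [ENNReal.ofReal_mul (h0 j)]
    by_cases hx : x ∈ binSet d b j <;> simp [hx]
  have hm := measurableSet_binSet d b
  rw [histMeasure, withDensity_apply _ hS]
  simp_rw [hdens]
  rw [lintegral_finsetSum _ fun j _ => (measurable_one.indicator (hm j)).const_mul _]
  refine Finset.sum_congr rfl fun j _ => ?_
  rw [lintegral_const_mul _ (measurable_one.indicator (hm j)), lintegral_indicator_one (hm j),
    Measure.restrict_apply (hm j)]

lemma histMeasure_univ {d b : ℕ} (hb : 0 < b) {w : (Fin d → Fin b) → ℝ} (hw : ∀ j, 0 ≤ w j) :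
    histMeasure d b w Set.univ = ENNReal.ofReal (∑ j, w j) := by
  rw [histMeasure_apply hw .univ, ENNReal.ofReal_sum_of_nonneg fun j _ => hw j]
  simp_rw [Set.inter_univ, ofReal_mul_volume_binSet hb]

lemma measurableSet_cube (d : ℕ) : MeasurableSet (cube d) := by
  have : cube d = Set.univ.pi fun _ => Set.Ico (0 : ℝ) 1 := by
    ext x
    simp [cube]
  rw [this]
  exact MeasurableSet.univ_pi fun _ => measurableSet_Ico

lemma ae_mem_cube_histMeasure {d b : ℕ} (hb : 0 < b) {w : (Fin d → Fin b) → ℝ}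
    (hw : ∀ j, 0 ≤ w j) : ∀ᵐ x ∂histMeasure d b w, x ∈ cube d := by
  change histMeasure d b w (cube d)ᶜ = 0
  rw [histMeasure_apply hw (measurableSet_cube d).compl]
  refine Finset.sum_eq_zero fun j _ => ?_
  rw [← Set.sdiff_eq, Set.sdiff_eq_empty.2 (binSet_subset_cube hb j), measure_empty, mul_zero]

lemma le_histMeasure_gridIndex {d k K : ℕ} {h : (Fin d → Fin (2 ^ K)) → (Fin d → Fin (2 ^ k))}
    (hh : ∀ x, gridIndex k x = h (gridIndex K x)) {w : (Fin d → Fin (2 ^ K)) → ℝ}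
    (hw : ∀ j, 0 ≤ w j) (i : Fin d → Fin (2 ^ k)) :
    ENNReal.ofReal (∑ j with h j = i, w j) ≤
      histMeasure d (2 ^ K) w (gridIndex k ⁻¹' {i}) := by
  rw [histMeasure_apply hw (measurable_gridIndex k (measurableSet_singleton i)),
    ENNReal.ofReal_sum_of_nonneg fun j _ => hw j]
  refine (Finset.sum_le_sum fun j hj => ?_).trans
    (Finset.sum_le_sum_of_subset (Finset.filter_subset (fun j => h j = i) _))
  have hsub : binSet d (2 ^ K) j ⊆ gridIndex k ⁻¹' {i} := by
    intro x hx
    have hj' := (mem_binSet_iff (binSet_subset_cube (by positivity) j hx) j).1 hx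
    rw [Set.mem_preimage, Set.mem_singleton_iff, hh, hj']
    exact (Finset.mem_filter.1 hj).2
  rw [Set.inter_eq_left.2 hsub, ofReal_mul_volume_binSet (by positivity)]

/-- The number of sample points in a given dyadic cell of side `2⁻ᵏ`. -/
def cellCount {d n : ℕ} (k : ℕ) (Y : Fin n → Fin d → ℝ) (i : Fin d → Fin (2 ^ k)) : ℕ :=
  (Finset.univ.filter fun t => gridIndex k (Y t) = i).card

lemma sum_cellCount {d n : ℕ} (k : ℕ) (Y : Fin n → Fin d → ℝ) : ∑ i, cellCount k Y i = n := by
  simpa [cellCount] using (Finset.card_eq_sum_card_fiberwise (s := Finset.univ) (t := Finset.univ)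
    (f := fun t => gridIndex k (Y t)) (by simp)).symm

lemma binCount_eq_cellCount {d n K : ℕ} {Y : Fin n → Fin d → ℝ} (hY : ∀ t, Y t ∈ cube d)
    (j : Fin d → Fin (2 ^ K)) : binCount d (2 ^ K) Y j = cellCount K Y j := by
  unfold binCount cellCount
  congr 1
  ext t
  simp [mem_binSet_iff (hY t)]

lemma sum_cellCount_fiber {d n k K : ℕ}
    {h : (Fin d → Fin (2 ^ K)) → (Fin d → Fin (2 ^ k))}
    (hh : ∀ x, gridIndex k x = h (gridIndex K x)) (Y : Fin n → Fin d → ℝ)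
    (i : Fin d → Fin (2 ^ k)) : ∑ j with h j = i, cellCount K Y j = cellCount k Y i := by
  unfold cellCount
  rw [Finset.card_eq_sum_card_fiberwise (s := Finset.univ.filter fun t => gridIndex k (Y t) = i)
    (t := Finset.univ.filter fun j => h j = i) (f := fun t => gridIndex K (Y t))]
  · refine Finset.sum_congr rfl fun j hj => ?_
    congr 1
    ext t
    simp only [Finset.mem_filter, Finset.mem_univ, true_and, hh]
    exact ⟨fun e => ⟨e ▸ (Finset.mem_filter.1 hj).2, e⟩, fun e => e.2⟩
  · intro t ht
    simpa [hh] using ht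

lemma postWeight_nonneg {d b n : ℕ} {α : (Fin d → Fin b) → ℝ} (hα : ∀ j, 0 ≤ α j)
    (Y : Fin n → Fin d → ℝ) (j : Fin d → Fin b) : 0 ≤ postWeight d b α Y j :=
  div_nonneg (add_nonneg (hα j) (by positivity))
    (add_nonneg (by positivity) (Finset.sum_nonneg fun j _ => hα j))

lemma sum_postWeight {d K n : ℕ} (hn : 0 < n) {α : (Fin d → Fin (2 ^ K)) → ℝ}
    (hα : ∀ j, 0 ≤ α j) {Y : Fin n → Fin d → ℝ} (hY : ∀ t, Y t ∈ cube d) :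
    ∑ j, postWeight d (2 ^ K) α Y j = 1 := by
  have hA : 0 ≤ ∑ j, α j := Finset.sum_nonneg fun j _ => hα j
  have hn' : (0 : ℝ) < n := by exact_mod_cast hn
  unfold postWeight
  simp_rw [binCount_eq_cellCount hY]
  rw [← Finset.sum_div, Finset.sum_add_distrib, ← Nat.cast_sum, sum_cellCount, add_comm,
    div_self (by positivity)]

lemma cellCount_div_le_sum_postWeight {d k K n : ℕ} {α : (Fin d → Fin (2 ^ K)) → ℝ}
    (hα : ∀ j, 0 ≤ α j) {Y : Fin n → Fin d → ℝ} (hY : ∀ t, Y t ∈ cube d)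
    {h : (Fin d → Fin (2 ^ K)) → (Fin d → Fin (2 ^ k))}
    (hh : ∀ x, gridIndex k x = h (gridIndex K x)) (i : Fin d → Fin (2 ^ k)) :
    (cellCount k Y i : ℝ) / (n + ∑ j, α j) ≤ ∑ j with h j = i, postWeight d (2 ^ K) α Y j := by
  have hA : 0 ≤ ∑ j, α j := Finset.sum_nonneg fun j _ => hα j
  unfold postWeight
  simp_rw [binCount_eq_cellCount hY]
  rw [← Finset.sum_div, Finset.sum_add_distrib, ← Nat.cast_sum, sum_cellCount_fiber hh]
  gcongr
  linarith [Finset.sum_nonneg fun j (_ : j ∈ Finset.univ.filter fun j => h j = i) => hα j]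

lemma wassersteinLp_le {p v : ℝ} (hv : 1 ≤ v) {d : ℕ} {μ ν : Measure (Fin d → ℝ)}
    [IsProbabilityMeasure μ] {γ : Measure ((Fin d → ℝ) × (Fin d → ℝ))}
    (h1 : γ.map Prod.fst = μ) (h2 : γ.map Prod.snd = ν) {G : ℝ} (hG : 0 ≤ G)
    (h : ∫⁻ z, ENNReal.ofReal (lpDist p z.1 z.2 ^ v) ∂γ ≤ ENNReal.ofReal G) :
    wassersteinLp p v μ ν ≤ G ^ (1 / v) := by
  have hγ : IsProbabilityMeasure γ := by
    refine ⟨?_⟩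
    rw [← Set.preimage_univ (f := Prod.fst), ← Measure.map_apply measurable_fst .univ, h1,
      measure_univ]
  have hnn : ∀ z : (Fin d → ℝ) × (Fin d → ℝ), 0 ≤ lpDist p z.1 z.2 ^ v :=
    fun z => Real.rpow_nonneg (lpDist_nonneg _ _ _) _
  have hint : ∫ z, lpDist p z.1 z.2 ^ v ∂γ ≤ G := by
    rw [integral_eq_lintegral_of_nonneg_ae (ae_of_all _ hnn)
      ((measurable_lpDist p).pow_const v).aestronglyMeasurable]
    exact ENNReal.toReal_le_of_le_ofReal hG h
  refine Real.rpow_le_rpow ?_ ?_ (by positivity)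
  · refine Real.sInf_nonneg ?_
    rintro r ⟨π, -, -, -, rfl⟩
    exact integral_nonneg hnn
  · refine le_trans (csInf_le ?_ ⟨γ, hγ, h1, h2, rfl⟩) hint
    refine ⟨0, ?_⟩
    rintro r ⟨π, -, -, -, rfl⟩
    exact integral_nonneg hnn

/-- Multiscale discrepancy between `P` and the empirical measure of `Y` over dyadic cells, together
with the discretization error at level `K` and a contribution of prior mass `A`. -/
def multiscaleBound {d n : ℕ} (D u A : ℝ) (K : ℕ) (P : Measure (Fin d → ℝ))
    (Y : Fin n → Fin d → ℝ) : ℝ :=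
  D * (u⁻¹ ^ K + ∑ k ∈ Finset.range K, u⁻¹ ^ k *
    (∑ i, |P.real (gridIndex (k + 1) ⁻¹' {i}) - cellCount (k + 1) Y i / n| + A / n))

lemma multiscaleBound_nonneg {d n : ℕ} {D u A : ℝ} (hD : 0 ≤ D) (hu : 0 ≤ u) (hA : 0 ≤ A) (K : ℕ)
    (P : Measure (Fin d → ℝ)) (Y : Fin n → Fin d → ℝ) : 0 ≤ multiscaleBound D u A K P Y := by
  unfold multiscaleBound
  have : ∀ k, 0 ≤ ∑ i, |P.real (gridIndex (k + 1) ⁻¹' {i}) - cellCount (k + 1) Y i / n| :=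
    fun k => Finset.sum_nonneg fun _ _ => abs_nonneg _
  exact mul_nonneg hD (add_nonneg (by positivity) (Finset.sum_nonneg fun k _ =>
    mul_nonneg (by positivity) (add_nonneg (this k) (by positivity))))

lemma wassersteinLp_histMeasure_postWeight_le {p v : ℝ} (hp : 1 ≤ p) (hv : 1 ≤ v) {d K n : ℕ}
    (hn : 0 < n) {α : (Fin d → Fin (2 ^ K)) → ℝ} (hα : ∀ j, 0 ≤ α j) {Y : Fin n → Fin d → ℝ}
    (hY : ∀ t, Y t ∈ cube d) (P : Measure (Fin d → ℝ)) [IsProbabilityMeasure P]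
    (hP : ∀ᵐ x ∂P, x ∈ cube d) :
    wassersteinLp p v P (histMeasure d (2 ^ K) (postWeight d (2 ^ K) α Y)) ≤
      multiscaleBound (((d : ℝ) ^ (1 / p)) ^ v) ((2 : ℝ) ^ v) (∑ j, α j) K P Y ^ (1 / v) := by
  set D : ℝ := ((d : ℝ) ^ (1 / p)) ^ v with hDdef
  set u : ℝ := (2 : ℝ) ^ v with hudef
  set A : ℝ := ∑ j, α j with hAdef
  have hD : 0 ≤ D := by positivity
  have hu : 0 < u := by positivity
  have hA : 0 ≤ A := Finset.sum_nonneg fun j _ => hα j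
  have hn' : (0 : ℝ) < n := by exact_mod_cast hn
  have hw := postWeight_nonneg hα Y
  set ν := histMeasure d (2 ^ K) (postWeight d (2 ^ K) α Y) with hνdef
  have hν1 : ν Set.univ = 1 := by
    rw [hνdef, histMeasure_univ (by positivity) hw, sum_postWeight hn hα hY, ENNReal.ofReal_one]
  have : IsFiniteMeasure ν := ⟨by rw [hν1]; exact ENNReal.one_lt_top⟩
  obtain ⟨γ, h1, h2, hγ⟩ := exists_multiscale_coupling (q := fun k => gridIndex (d := d) k)
    (S := cube d) (cost := fun z => ENNReal.ofReal (lpDist p z.1 z.2 ^ v))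
    (δ := fun k => ENNReal.ofReal (D * u⁻¹ ^ k)) measurable_gridIndex
    (fun k K hkK => gridIndex_factors hkK)
    (fun x hx y hy => ENNReal.ofReal_le_ofReal (lpDist_rpow_le hp hv hx hy (by
      funext l
      exact Fin.ext (by simp [gridIndex, Nat.mod_one]))))
    (fun k x hx y hy hxy => ENNReal.ofReal_le_ofReal (lpDist_rpow_le hp hv hx hy hxy)) K P ν
    (by rw [hν1, measure_univ]) hP (ae_mem_cube_histMeasure (by positivity) hw)
  refine wassersteinLp_le hv h1 h2
    (multiscaleBound_nonneg hD hu.le hA K P Y) (hγ.trans ?_)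
  have hcell : ∀ k ∈ Finset.range K, ∀ i : Fin d → Fin (2 ^ (k + 1)),
      P (gridIndex (k + 1) ⁻¹' {i}) - ν (gridIndex (k + 1) ⁻¹' {i}) ≤
        ENNReal.ofReal (|P.real (gridIndex (k + 1) ⁻¹' {i}) - cellCount (k + 1) Y i / n| +
          cellCount (k + 1) Y i / n * (A / n)) := by
    intro k hk i
    obtain ⟨h, hh⟩ := gridIndex_factors (d := d) (Finset.mem_range.1 hk)
    have hle := (ENNReal.ofReal_le_ofReal (cellCount_div_le_sum_postWeight hα hY hh i)).trans
      (le_histMeasure_gridIndex hh hw i)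
    refine (tsub_le_tsub_left hle _).trans ?_
    rw [← ofReal_measureReal, ← ENNReal.ofReal_sub _ (by positivity)]
    refine ENNReal.ofReal_le_ofReal ?_
    have e1 : (cellCount (k + 1) Y i : ℝ) / n - cellCount (k + 1) Y i / (n + A) ≤
        cellCount (k + 1) Y i / n * (A / n) := by
      have : (cellCount (k + 1) Y i : ℝ) / n - cellCount (k + 1) Y i / (n + A) =
          cellCount (k + 1) Y i / n * (A / (n + A)) := by
        field_simp
        ring
      rw [this]
      gcongr
      linarith
    linarith [le_abs_self (P.real (gridIndex (k + 1) ⁻¹' {i}) - cellCount (k + 1) Y i / n)]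
  have hlevel : ∀ k ∈ Finset.range K,
      ∑ i, (P (gridIndex (k + 1) ⁻¹' {i}) - ν (gridIndex (k + 1) ⁻¹' {i})) ≤
        ENNReal.ofReal (∑ i, |P.real (gridIndex (k + 1) ⁻¹' {i}) - cellCount (k + 1) Y i / n| +
          A / n) := by
    intro k hk
    refine (Finset.sum_le_sum fun i _ => hcell k hk i).trans ?_
    rw [← ENNReal.ofReal_sum_of_nonneg fun i _ => add_nonneg (abs_nonneg _) (by positivity),
      Finset.sum_add_distrib, ← Finset.sum_mul, ← Finset.sum_div, ← Nat.cast_sum, sum_cellCount,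
      div_self hn'.ne', one_mul]
  have hnn : ∀ k, 0 ≤ ∑ i, |P.real (gridIndex (k + 1) ⁻¹' {i}) - cellCount (k + 1) Y i / n| +
      A / n := fun k => add_nonneg (Finset.sum_nonneg fun _ _ => abs_nonneg _) (by positivity)
  calc _ ≤ ENNReal.ofReal (D * u⁻¹ ^ K) + ∑ k ∈ Finset.range K, ENNReal.ofReal (D * u⁻¹ ^ k) *
        ENNReal.ofReal (∑ i, |P.real (gridIndex (k + 1) ⁻¹' {i}) - cellCount (k + 1) Y i / n| +
          A / n) := by
        rw [measure_univ, mul_one]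
        gcongr with k hk
        exact hlevel k hk
    _ = _ := by
        simp_rw [← ENNReal.ofReal_mul (show 0 ≤ D * u⁻¹ ^ _ by positivity)]
        rw [← ENNReal.ofReal_sum_of_nonneg fun k _ => mul_nonneg (by positivity) (hnn k),
          ← ENNReal.ofReal_add (by positivity)
            (Finset.sum_nonneg fun k _ => mul_nonneg (by positivity) (hnn k))]
        rw [multiscaleBound, mul_add, Finset.mul_sum]
        simp_rw [mul_assoc]

lemma cellCount_eq_sum_indicator {d n k : ℕ} (Y : Fin n → Fin d → ℝ) (i : Fin d → Fin (2 ^ k)) :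
    (cellCount k Y i : ℝ) =
      ∑ t, (gridIndex k ⁻¹' {i}).indicator (1 : (Fin d → ℝ) → ℝ) (Y t) := by
  simp [cellCount, Set.indicator_apply]

lemma memLp_indicator_cell {d k : ℕ} (P : Measure (Fin d → ℝ)) [IsProbabilityMeasure P]
    (i : Fin d → Fin (2 ^ k)) :
    MemLp ((gridIndex k ⁻¹' {i}).indicator (1 : (Fin d → ℝ) → ℝ)) 2 P :=
  memLp_indicator_const 2 (measurable_gridIndex k (measurableSet_singleton i)) 1
    (Or.inr (measure_ne_top _ _))

lemma integrable_cellCount {d n : ℕ} (P : Measure (Fin d → ℝ)) [IsProbabilityMeasure P] (k : ℕ)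
    (i : Fin d → Fin (2 ^ k)) :
    Integrable (fun Y : Fin n → Fin d → ℝ => (cellCount k Y i : ℝ))
      (Measure.pi fun _ : Fin n => P) := by
  simp_rw [cellCount_eq_sum_indicator]
  exact integrable_finsetSum _ fun t _ =>
    ((memLp_indicator_cell P i).comp_measurePreserving (measurePreserving_eval _ t)).integrable
      one_le_two

lemma integral_abs_sub_cellCount_le {d n : ℕ} (hn : 0 < n) (P : Measure (Fin d → ℝ))
    [IsProbabilityMeasure P] (k : ℕ) (i : Fin d → Fin (2 ^ k)) {s : ℝ} (hs : 0 < s) :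
    ∫ Y, |P.real (gridIndex k ⁻¹' {i}) - cellCount k Y i / n| ∂(Measure.pi fun _ : Fin n => P) ≤
      (s + P.real (gridIndex k ⁻¹' {i}) / (n * s)) / 2 := by
  have hn' : (0 : ℝ) < n := by exact_mod_cast hn
  set Q : Set (Fin d → ℝ) := gridIndex k ⁻¹' {i} with hQdef
  have hQ : MeasurableSet Q := measurable_gridIndex k (measurableSet_singleton i)
  set f : (Fin d → ℝ) → ℝ := Q.indicator 1 with hf
  have hfL : MemLp f 2 P := memLp_indicator_cell P i
  set X : (Fin n → Fin d → ℝ) → ℝ := ∑ t : Fin n, fun Y => f (Y t) with hX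
  have hXapp : ∀ Y, X Y = cellCount k Y i := by
    intro Y
    rw [cellCount_eq_sum_indicator, hX, Finset.sum_apply]
  have hXL : MemLp X 2 (Measure.pi fun _ : Fin n => P) :=
    memLp_finsetSum' _ fun t _ => hfL.comp_measurePreserving (measurePreserving_eval _ t)
  have hmean : ∫ Y, X Y ∂(Measure.pi fun _ : Fin n => P) = n * P.real Q := by
    simp_rw [hX, Finset.sum_apply]
    have hfi : ∀ t : Fin n, Integrable (fun Y : Fin n → Fin d → ℝ => f (Y t))
        (Measure.pi fun _ : Fin n => P) := fun t =>
      (hfL.comp_measurePreserving (measurePreserving_eval _ t)).integrable one_le_two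
    rw [integral_finsetSum _ fun t _ => hfi t]
    have : ∀ t : Fin n, ∫ Y, f (Y t) ∂(Measure.pi fun _ : Fin n => P) = P.real Q := by
      intro t
      rw [integral_comp_eval (μ := fun _ : Fin n => P) hfL.aestronglyMeasurable, hf,
        integral_indicator_one hQ]
    simp [this]
  have hvar : ∫ Y, (X Y - n * P.real Q) ^ 2 ∂(Measure.pi fun _ : Fin n => P) ≤ n * P.real Q := by
    have hv := ProbabilityTheory.variance_eq_integral hXL.aemeasurable
    rw [hmean] at hv
    rw [← hv, hX,
      ProbabilityTheory.variance_sum_pi (X := fun _ => f) fun _ => hfL]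
    have h1 : ProbabilityTheory.variance f P ≤ P.real Q := by
      refine (ProbabilityTheory.variance_le_expectation_sq hfL.aestronglyMeasurable).trans_eq ?_
      rw [← integral_indicator_one hQ]
      refine integral_congr_ae (ae_of_all _ fun x => ?_)
      by_cases hx : x ∈ Q <;> simp [hf, hx]
    simpa using mul_le_mul_of_nonneg_left h1 hn'.le
  have hsqi : Integrable (fun Y => (X Y - n * P.real Q) ^ 2) (Measure.pi fun _ : Fin n => P) :=
    (hXL.sub (memLp_const _)).integrable_sq
  calc ∫ Y, |P.real Q - cellCount k Y i / n| ∂(Measure.pi fun _ : Fin n => P)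
      ≤ ∫ Y, (s / 2 + (X Y - n * P.real Q) ^ 2 * (2 * n ^ 2 * s)⁻¹)
          ∂(Measure.pi fun _ : Fin n => P) := by
        refine integral_mono_of_nonneg (ae_of_all _ fun _ => abs_nonneg _)
          ((integrable_const _).add (hsqi.mul_const _)) (ae_of_all _ fun Y => ?_)
        change |P.real Q - cellCount k Y i / n| ≤
          s / 2 + (X Y - n * P.real Q) ^ 2 * (2 * n ^ 2 * s)⁻¹
        rw [hXapp]
        set t := |P.real Q - cellCount k Y i / n| with ht
        have e : ((cellCount k Y i : ℝ) - n * P.real Q) ^ 2 * (2 * n ^ 2 * s)⁻¹ =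
            t ^ 2 / (2 * s) := by
          rw [ht, sq_abs]
          field_simp
          ring
        rw [e, ← sub_nonneg]
        have : s / 2 + t ^ 2 / (2 * s) - t = (s - t) ^ 2 / (2 * s) := by
          field_simp
          ring
        rw [this]
        positivity
    _ = s / 2 + (∫ Y, (X Y - n * P.real Q) ^ 2 ∂(Measure.pi fun _ : Fin n => P)) *
          (2 * n ^ 2 * s)⁻¹ := by
        rw [integral_add (integrable_const _) (hsqi.mul_const _), integral_mul_const]
        simp
    _ ≤ s / 2 + (n * P.real Q) * (2 * n ^ 2 * s)⁻¹ := by gcongr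
    _ = _ := by
        field_simp

lemma integrable_abs_sub_cellCount {d n : ℕ} (P : Measure (Fin d → ℝ)) [IsProbabilityMeasure P]
    (k : ℕ) (i : Fin d → Fin (2 ^ k)) :
    Integrable (fun Y : Fin n → Fin d → ℝ =>
      |P.real (gridIndex k ⁻¹' {i}) - cellCount k Y i / n|) (Measure.pi fun _ : Fin n => P) :=
  ((integrable_const _).sub ((integrable_cellCount P k i).div_const _)).abs

lemma integrable_multiscaleBound {d n : ℕ} (D u A : ℝ) (K : ℕ) (P : Measure (Fin d → ℝ))
    [IsProbabilityMeasure P] :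
    Integrable (fun Y : Fin n → Fin d → ℝ => multiscaleBound D u A K P Y)
      (Measure.pi fun _ : Fin n => P) :=
  ((integrable_const _).add (integrable_finsetSum _ fun k _ =>
    ((integrable_finsetSum _ fun i _ =>
      integrable_abs_sub_cellCount P (k + 1) i).add (integrable_const _)).const_mul _)).const_mul _

lemma integral_sum_abs_sub_cellCount_le {d n : ℕ} (hn : 0 < n) (P : Measure (Fin d → ℝ))
    [IsProbabilityMeasure P] (k : ℕ) {u : ℝ} (hu : 0 < u) (hud : u ^ 2 = 2 ^ d) :
    ∫ Y, ∑ i, |P.real (gridIndex k ⁻¹' {i}) - cellCount k Y i / n|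
      ∂(Measure.pi fun _ : Fin n => P) ≤ u ^ k / √n := by
  have hn' : (0 : ℝ) < n := by exact_mod_cast hn
  have hsq : (0 : ℝ) < √n := Real.sqrt_pos.2 hn'
  have hsq2 : √(n : ℝ) ^ 2 = n := Real.sq_sqrt hn'.le
  set s : ℝ := (u ^ k * √n)⁻¹ with hs
  have hs0 : 0 < s := by positivity
  have hP : ∑ i : Fin d → Fin (2 ^ k), P.real (gridIndex k ⁻¹' {i}) = 1 := by
    rw [sum_measureReal_preimage_singleton _
      fun i _ => measurable_gridIndex k (measurableSet_singleton i)]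
    simp
  have hcard : ((2 ^ k) ^ d : ℝ) = (u ^ k) ^ 2 := by
    rw [← pow_mul, ← pow_mul, mul_comm k d, mul_comm k 2, pow_mul, pow_mul, hud]
  rw [integral_finsetSum _ fun i _ => integrable_abs_sub_cellCount P k i]
  calc _ ≤ ∑ i : Fin d → Fin (2 ^ k), (s + P.real (gridIndex k ⁻¹' {i}) / (n * s)) / 2 :=
        Finset.sum_le_sum fun i _ => integral_abs_sub_cellCount_le hn P k i hs0
    _ = ((2 ^ k) ^ d * s + 1 / (n * s)) / 2 := by
        rw [← Finset.sum_div, Finset.sum_add_distrib, ← Finset.sum_div, hP]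
        simp
    _ = u ^ k / √n := by
        have hns : n * s = √n / u ^ k := by
          rw [hs]
          field_simp
          exact hsq2.symm
        rw [hcard, hns, hs]
        field_simp
        ring

lemma integral_multiscaleBound_le {d n K : ℕ} (hn : 0 < n) (P : Measure (Fin d → ℝ))
    [IsProbabilityMeasure P] {D u A c : ℝ} (hD : 0 ≤ D) (hu : 1 ≤ u) (hud : u ^ 2 = 2 ^ d)
    (hA0 : 0 ≤ A) (hA : A ≤ c * √n) (hK : √n ≤ u ^ K) :
    ∫ Y, multiscaleBound D u A K P Y ∂(Measure.pi fun _ : Fin n => P) ≤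
      D * (1 + K * (u + c)) / √n := by
  have hn' : (0 : ℝ) < n := by exact_mod_cast hn
  have hsq : (0 : ℝ) < √n := Real.sqrt_pos.2 hn'
  have hu0 : 0 < u := by linarith
  have hsum : ∀ k, Integrable (fun Y : Fin n → Fin d → ℝ =>
      ∑ i, |P.real (gridIndex (k + 1) ⁻¹' {i}) - cellCount (k + 1) Y i / n|)
      (Measure.pi fun _ : Fin n => P) := fun k =>
    integrable_finsetSum _ fun i _ => integrable_abs_sub_cellCount P (k + 1) i
  have hterm : ∀ k, Integrable (fun Y : Fin n → Fin d → ℝ => u⁻¹ ^ k *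
      (∑ i, |P.real (gridIndex (k + 1) ⁻¹' {i}) - cellCount (k + 1) Y i / n| + A / n))
      (Measure.pi fun _ : Fin n => P) := fun k =>
    ((hsum k).add (integrable_const _)).const_mul _
  have hAn : A / n ≤ c / √n := by
    rw [div_le_div_iff₀ hn' hsq]
    nlinarith [Real.mul_self_sqrt hn'.le]
  unfold multiscaleBound
  rw [integral_const_mul, integral_add (integrable_const _) (integrable_finsetSum _ fun k _ =>
    hterm k), integral_finsetSum _ fun k _ => hterm k]
  simp_rw [integral_const_mul]
  have hlevel : ∀ k ∈ Finset.range K, u⁻¹ ^ k * ∫ Y,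
      (∑ i, |P.real (gridIndex (k + 1) ⁻¹' {i}) - cellCount (k + 1) Y i / n| + A / n)
        ∂(Measure.pi fun _ : Fin n => P) ≤ (u + c) / √n := by
    intro k _
    rw [integral_add (hsum k) (integrable_const _), integral_const, probReal_univ, one_smul]
    have hk1 : u⁻¹ ^ k ≤ 1 := pow_le_one₀ (by positivity) (inv_le_one_of_one_le₀ hu)
    calc _ ≤ u⁻¹ ^ k * (u ^ (k + 1) / √n + A / n) := by
          gcongr
          exact integral_sum_abs_sub_cellCount_le hn P (k + 1) hu0 hud
      _ = u / √n + u⁻¹ ^ k * (A / n) := by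
          rw [inv_pow, pow_succ]
          field_simp
      _ ≤ u / √n + 1 * (A / n) := by gcongr
      _ ≤ _ := by
          rw [add_div]
          linarith
  have hbase : u⁻¹ ^ K ≤ 1 / √n := by
    rw [inv_pow, ← one_div]
    exact one_div_le_one_div_of_le hsq hK
  calc _ ≤ D * (1 / √n + ∑ k ∈ Finset.range K, (u + c) / √n) := by
        rw [integral_const, probReal_univ, one_smul]
        gcongr with k hk
        exact hlevel k hk
    _ = _ := by
        rw [Finset.sum_const, Finset.card_range, nsmul_eq_mul]
        ring

lemma rpow_le_mul_one_add_div {G B r : ℝ} (hG : 0 ≤ G) (hB : 0 < B) (hr0 : 0 ≤ r) (hr : r ≤ 1) :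
    G ^ r ≤ B ^ r * (1 + G / B) := by
  have h : (G / B) ^ r ≤ 1 + G / B := by
    have hGB : 0 ≤ G / B := by positivity
    calc (G / B) ^ r ≤ (1 + G / B) ^ r := Real.rpow_le_rpow hGB (by linarith) hr0
      _ ≤ (1 + G / B) ^ (1 : ℝ) := Real.rpow_le_rpow_of_exponent_le (by linarith) hr
      _ = _ := Real.rpow_one _
  calc G ^ r = (B * (G / B)) ^ r := by rw [mul_div_cancel₀ _ hB.ne']
    _ = B ^ r * (G / B) ^ r := Real.mul_rpow hB.le (by positivity)
    _ ≤ _ := by gcongr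

lemma sqrt_le_two_rpow_pow_KSeq {d n : ℕ} {v : ℝ} (hv : 1 ≤ v) (hdv : (d : ℝ) = 2 * v)
    (hn : 0 < n) : √n ≤ ((2 : ℝ) ^ v) ^ KSeq d v n := by
  have hn' : (0 : ℝ) < n := by exact_mod_cast hn
  have hk : kSeq d v n = (n : ℝ) ^ ((1 : ℝ) / (2 * v)) := if_pos hdv.le
  have hle : (n : ℝ) ^ ((1 : ℝ) / (2 * v)) ≤ (2 : ℝ) ^ (KSeq d v n : ℝ) := by
    rw [← Real.logb_le_iff_le_rpow one_lt_two (by positivity), ← hk]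
    exact Nat.le_ceil _
  have := Real.rpow_le_rpow (by positivity) hle (show 0 ≤ v by linarith)
  rw [← Real.rpow_mul hn'.le, ← Real.rpow_mul zero_le_two] at this
  rw [Real.sqrt_eq_rpow, ← Real.rpow_mul_natCast zero_le_two, mul_comm v]
  convert this using 2
  field_simp

lemma KSeq_le_two_mul_log {d n : ℕ} {v : ℝ} (hv : 1 ≤ v) (hdv : (d : ℝ) = 2 * v)
    (hlog : 1 ≤ Real.log n) : (KSeq d v n : ℝ) ≤ 2 * Real.log n := by
  have hn' : (0 : ℝ) < n := by
    rcases Nat.eq_zero_or_pos n with rfl | h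
    · norm_num at hlog
    · exact_mod_cast h
  have hk : kSeq d v n = (n : ℝ) ^ ((1 : ℝ) / (2 * v)) := if_pos hdv.le
  have hl2 := Real.log_two_gt_d9
  have hlogb : Real.logb 2 (kSeq d v n) = Real.log n / (2 * v * Real.log 2) := by
    rw [hk, Real.logb, Real.log_rpow hn']
    field_simp
  have hle : Real.logb 2 (kSeq d v n) ≤ Real.log n := by
    rw [hlogb]
    exact div_le_self (by linarith) (by nlinarith)
  have hnn : 0 ≤ Real.logb 2 (kSeq d v n) := by
    rw [hlogb]
    exact div_nonneg (by linarith) (by nlinarith)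
  have := Nat.ceil_lt_add_one hnn
  unfold KSeq
  linarith

/-- For d = 2v, under the prior-mass bound Σ_j α_{j,b_n} ≤ c·n^{1/2}, the posterior
mean histogram attains the rate n^{-1/(2v)}·(log n)^{1/v} in expected Wasserstein-v loss,
uniformly over Borel probability measures P₀ on [0,1)^d. -/
theorem bayes_histogram_rate_d_eq_2v
    (d : ℕ) (hd : 1 ≤ d) (p v : ℝ) (hp : 1 ≤ p) (hv : 1 ≤ v) (hdv : (d : ℝ) = 2 * v)
    (α : ∀ n : ℕ, (Fin d → Fin (bSeq d v n)) → ℝ) (c : ℝ) (hc : 0 < c)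
    (hα0 : ∀ n j, 0 ≤ α n j)
    (hαsum : ∀ n : ℕ, ∑ j, α n j ≤ c * (n : ℝ) ^ ((1 : ℝ) / 2)) :
    ∃ C > (0 : ℝ), ∃ N : ℕ, 2 ≤ N ∧ ∀ n ≥ N, ∀ P₀ : Measure (Fin d → ℝ),
      IsProbabilityMeasure P₀ → P₀ (cube d) = 1 →
      ∫ Y, wassersteinLp p v P₀ (postMeanHist d v (α n) Y)
          ∂(Measure.pi fun _ : Fin n => P₀)
        ≤ C * (n : ℝ) ^ (-(1 / (2 * v))) * Real.log n ^ ((1 : ℝ) / v) := by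
  set D : ℝ := ((d : ℝ) ^ (1 / p)) ^ v with hDdef
  set u : ℝ := (2 : ℝ) ^ v with hudef
  have hd' : (0 : ℝ) < d := by exact_mod_cast hd
  have hD : 0 < D := by positivity
  have hu : 1 ≤ u := Real.one_le_rpow one_le_two (by linarith)
  have hud : u ^ 2 = 2 ^ d := by
    rw [hudef, ← Real.rpow_mul_natCast zero_le_two, ← Real.rpow_natCast, hdv]
    congr 1
    push_cast
    ring
  set L : ℝ := D * (1 + 2 * (u + c)) with hL
  have hL0 : 0 < L := by positivity
  refine ⟨2 * L ^ (1 / v), by positivity, 3, by norm_num, fun n hn P hP hcube => ?_⟩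
  have hn0 : 0 < n := by omega
  have hn' : (0 : ℝ) < n := by exact_mod_cast hn0
  have hlog : 1 ≤ Real.log n := by
    rw [Real.le_log_iff_exp_le hn']
    have : (3 : ℝ) ≤ n := by exact_mod_cast hn
    linarith [Real.exp_one_lt_d9]
  have hPcube : ∀ᵐ x ∂P, x ∈ cube d := (prob_compl_eq_zero_iff (measurableSet_cube d)).2 hcube
  have hYcube : ∀ᵐ Y ∂(Measure.pi fun _ : Fin n => P), ∀ t, Y t ∈ cube d :=
    ae_all_iff.2 fun t => (measurePreserving_eval (fun _ : Fin n => P) t).quasiMeasurePreserving.ae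
      hPcube
  set B : ℝ := L * Real.log n / √n with hB
  have hsq : 0 < √(n : ℝ) := Real.sqrt_pos.2 hn'
  have hB0 : 0 < B := by positivity
  set A : ℝ := ∑ j, α n j with hAdef
  have hA0 : 0 ≤ A := Finset.sum_nonneg fun j _ => hα0 n j
  have hEG : ∫ Y, multiscaleBound D u A (KSeq d v n) P Y ∂(Measure.pi fun _ : Fin n => P) ≤ B := by
    refine (integral_multiscaleBound_le hn0 P hD.le hu hud hA0
      (by rw [Real.sqrt_eq_rpow]; exact hαsum n) (sqrt_le_two_rpow_pow_KSeq hv hdv hn0)).trans ?_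
    rw [hB, hL, mul_assoc]
    gcongr
    have h1 := KSeq_le_two_mul_log hv hdv hlog
    have h2 := mul_le_mul_of_nonneg_right h1 (show 0 ≤ u + c by linarith)
    linarith
  calc ∫ Y, wassersteinLp p v P (postMeanHist d v (α n) Y) ∂(Measure.pi fun _ : Fin n => P)
      ≤ ∫ Y, B ^ (1 / v) * (1 + multiscaleBound D u A (KSeq d v n) P Y / B)
          ∂(Measure.pi fun _ : Fin n => P) := by
        refine integral_mono_of_nonneg (ae_of_all _ fun Y => ?_) (((integrable_const _).add
          ((integrable_multiscaleBound D u A _ P).div_const B)).const_mul _) ?_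
        · refine Real.rpow_nonneg (Real.sInf_nonneg ?_) _
          rintro r ⟨π, -, -, -, rfl⟩
          exact integral_nonneg fun z => Real.rpow_nonneg (lpDist_nonneg _ _ _) _
        · filter_upwards [hYcube] with Y hY
          exact (wassersteinLp_histMeasure_postWeight_le hp hv hn0 (hα0 n) hY P hPcube).trans
            (rpow_le_mul_one_add_div (multiscaleBound_nonneg hD.le (by linarith) hA0 _ P Y) hB0
              (by positivity) (div_le_one_of_le₀ hv (by linarith)))
    _ = B ^ (1 / v) * (1 + (∫ Y, multiscaleBound D u A (KSeq d v n) P Y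
          ∂(Measure.pi fun _ : Fin n => P)) / B) := by
        rw [integral_const_mul, integral_add (integrable_const _)
          ((integrable_multiscaleBound D u A _ P).div_const B), integral_div]
        simp
    _ ≤ B ^ (1 / v) * (1 + B / B) := by gcongr
    _ = _ := by
        rw [div_self hB0.ne', hB, Real.div_rpow (by positivity) (by positivity),
          Real.mul_rpow hL0.le (by linarith), Real.sqrt_eq_rpow, ← Real.rpow_mul hn'.le,
          Real.rpow_neg hn'.le, show (1 : ℝ) / 2 * (1 / v) = 1 / (2 * v) by ring]
        ring

end
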